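/- arXiv:2207.03699 — 9 statements merged into one kernel-verified Lean document; each statement's English description precedes it below -/
import Mathlib

section
/- Suppose δ ≥ ε. Then the convex hull of S* equals Q1, i.e., conv(S*) = {(r, f) ∈ ℝ² : 0 ≤ r ≤ 1, 0 ≤ f ≤ γ, f ≤ δ·(r − 1) + υ}. -/
open Finset

theorem Convex.mk_mem_of_weights {C : Set (ℝ × ℝ)} (hC : Convex ℝ C) {a b c d x y : ℝ}
    (v w : ℝ) (hv : 0 ≤ v) (hw : 0 ≤ w) (hvw : 0 < v + w) (hp : (a, b) ∈ C) (hq : (c, d) ∈ C)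
    (hx : (v + w) * x = v * a + w * c) (hy : (v + w) * y = v * b + w * d) : (x, y) ∈ C := by
  have h := hC hp hq (div_nonneg hv hvw.le) (div_nonneg hw hvw.le)
    (by rw [← add_div, div_self hvw.ne'])
  convert h using 1
  ext
  · simp only [Prod.fst_add, Prod.smul_fst, smul_eq_mul]
    field_simp
    linarith
  · simp only [Prod.snd_add, Prod.smul_snd, smul_eq_mul]
    field_simp
    linarith

theorem stmt_0
    (n : ℕ) (hn : 0 < n)
    (γ υ : ℝ) (hυ : 0 < υ) (hγυ : υ < γ)
    (O : Set ℝ)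
    (hO : O = {r : ℝ | ∃ k : ℕ, k ≤ 2 ^ (n - 1) ∧ r = (k : ℝ) * 2 ^ ((1 : ℤ) - (n : ℤ))})
    (Sstar : Set (ℝ × ℝ))
    (hS : Sstar = {p : ℝ × ℝ | p.1 ∈ O ∧ 0 ≤ p.2 ∧ p.2 ≤ γ ∧ p.2 * p.1 ≤ υ})
    (μm μp : ℝ)
    (hμm : μm = 2 ^ ((1 : ℤ) - (n : ℤ)) * (⌊υ / (2 ^ ((1 : ℤ) - (n : ℤ)) * γ)⌋ : ℝ))
    (hμp : μp = μm + 2 ^ ((1 : ℤ) - (n : ℤ)))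
    (δ ε : ℝ)
    (hδ : δ = (γ - υ) / (μm - 1))
    (hε : ε = (γ - υ / μp) / (μm - μp))
    (Q1 : Set (ℝ × ℝ))
    (hQ1 : Q1 = {p : ℝ × ℝ | 0 ≤ p.1 ∧ p.1 ≤ 1 ∧ 0 ≤ p.2 ∧ p.2 ≤ γ ∧ p.2 ≤ δ * (p.1 - 1) + υ})
    (hcase : δ ≥ ε)
    :
    convexHull ℝ Sstar = Q1 := by
  have hh : (0 : ℝ) < 2 ^ ((1 : ℤ) - (n : ℤ)) := by positivity
  have hN : ((2 ^ (n - 1) : ℕ) : ℝ) * 2 ^ ((1 : ℤ) - (n : ℤ)) = 1 := by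
    obtain ⟨m, rfl⟩ : ∃ m, n = m + 1 := ⟨n - 1, by omega⟩
    have : (1 : ℤ) - ((m + 1 : ℕ) : ℤ) = -(m : ℤ) := by push_cast; ring
    rw [this, zpow_neg, zpow_natCast]
    simp
  generalize (2 : ℝ) ^ ((1 : ℤ) - (n : ℤ)) = h at *
  generalize 2 ^ (n - 1) = N at *
  have hγ : 0 < γ := hυ.trans hγυ
  have hhγ : 0 < h * γ := mul_pos hh hγ
  obtain ⟨m, hm⟩ : ∃ m : ℕ, ⌊υ / (h * γ)⌋ = (m : ℤ) :=
    Int.eq_ofNat_of_zero_le (Int.floor_nonneg.2 (by positivity))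
  have hfloor := Int.floor_le (υ / (h * γ))
  have hlt := Int.lt_floor_add_one (υ / (h * γ))
  rw [hm, Int.cast_natCast] at hμm hfloor hlt
  rw [le_div_iff₀ hhγ] at hfloor
  rw [div_lt_iff₀ hhγ] at hlt
  have hμmγ : μm * γ ≤ υ := by rw [hμm]; linarith
  have hμm0 : 0 ≤ μm := by rw [hμm]; positivity
  have hmN : m + 1 ≤ N := by
    by_contra! hc
    have hc' : (N : ℝ) ≤ m := by exact_mod_cast Nat.lt_succ_iff.1 hc
    have : (1 : ℝ) ≤ μm := by
      rw [hμm, ← hN, mul_comm h]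
      exact mul_le_mul_of_nonneg_right hc' hh.le
    nlinarith
  have hμp1 : μp ≤ 1 := by
    have : ((m + 1 : ℕ) : ℝ) ≤ N := by exact_mod_cast hmN
    have := mul_le_mul_of_nonneg_right this hh.le
    push_cast at this
    rw [hμp, hμm]
    linarith
  have hμp0 : 0 < μp := by linarith
  have hμm1 : 0 < 1 - μm := by linarith
  obtain ⟨s, hs⟩ : ∃ s, s = -δ := ⟨_, rfl⟩
  have hδs : δ = -s := by linarith
  have hsm : s * (1 - μm) = γ - υ := by
    have : μm - 1 ≠ 0 := by linarith
    rw [hs, hδ]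
    field_simp
    ring
  have hs0 : 0 < s := by
    by_contra! hc
    nlinarith
  have hslope : 0 ≤ (1 - μp) * (s * μp - υ) := by
    have hεh : ε * h = -(γ - υ / μp) := by
      have : μm - μp = -h := by linarith
      rw [hε, this]
      field_simp
    have hsh : ε * h ≤ -s * h := by rw [← hδs]; exact mul_le_mul_of_nonneg_right hcase hh.le
    have hle : υ / μp ≤ υ + s * (1 - μp) := by
      rw [hμp] at *
      linarith
    rw [div_le_iff₀ hμp0] at hle
    linarith
  have hmem : ∀ {x y : ℝ}, (x, y) ∈ Q1 ↔
      0 ≤ x ∧ x ≤ 1 ∧ 0 ≤ y ∧ y ≤ γ ∧ y ≤ υ + s * (1 - x) := by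
    intro x y
    have : δ * (x - 1) + υ = υ + s * (1 - x) := by rw [hδs]; ring
    simp only [hQ1, Set.mem_ofPred_eq, this]
  apply Set.Subset.antisymm
  · apply convexHull_min
    · rintro ⟨x, y⟩ hxy
      rw [hS, hO] at hxy
      obtain ⟨⟨k, hk, hx⟩, hy0, hyγ, hyx⟩ := hxy
      simp only at hx hy0 hyγ hyx
      have hx0 : 0 ≤ x := by rw [hx]; positivity
      have hx1 : x ≤ 1 := by
        rw [hx, ← hN]
        exact mul_le_mul_of_nonneg_right (by exact_mod_cast hk) hh.le
      refine hmem.2 ⟨hx0, hx1, hy0, hyγ, ?_⟩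
      rcases Nat.lt_or_ge m k with hmk | hkm
      · have hpx : μp ≤ x := by
          have : ((m + 1 : ℕ) : ℝ) ≤ k := by exact_mod_cast hmk
          have := mul_le_mul_of_nonneg_right this hh.le
          push_cast at this
          rw [hμp, hμm, hx]
          linarith
        have hcross : 0 ≤ (1 - x) * (s * x - υ) := by
          rcases hμp1.eq_or_lt with h1 | h1
          · have : x = 1 := by linarith
            simp [this]
          · have := nonneg_of_mul_nonneg_right hslope (sub_pos.2 h1)
            have := mul_le_mul_of_nonneg_left hpx hs0.le
            exact mul_nonneg (by linarith) (by linarith)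
        refine le_of_mul_le_mul_right ?_ (hμp0.trans_le hpx)
        linarith
      · have hxm : x ≤ μm := by
          rw [hμm, hx, mul_comm h]
          exact mul_le_mul_of_nonneg_right (by exact_mod_cast hkm) hh.le
        have := mul_le_mul_of_nonneg_left hxm hs0.le
        linarith
    · have hconv : Q1 = Set.Icc (0 : ℝ) 1 ×ˢ Set.Icc (0 : ℝ) γ ∩
          {p | s * p.1 + p.2 ≤ υ + s} := by
        ext ⟨x, y⟩
        rw [hmem]
        simp only [Set.mem_inter_iff, Set.mem_prod, Set.mem_Icc, Set.mem_ofPred_eq]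
        constructor
        · rintro ⟨h1, h2, h3, h4, h5⟩
          exact ⟨⟨⟨h1, h2⟩, h3, h4⟩, by linarith⟩
        · rintro ⟨⟨⟨h1, h2⟩, h3, h4⟩, h5⟩
          exact ⟨h1, h2, h3, h4, by linarith⟩
      rw [hconv]
      exact ((convex_Icc 0 1).prod (convex_Icc 0 γ)).inter
        (convex_halfSpace_le (s • LinearMap.fst ℝ ℝ ℝ + LinearMap.snd ℝ ℝ ℝ).isLinear _)
  · have hC := convex_convexHull ℝ Sstar
    have hvertex : ∀ (k : ℕ) (y : ℝ), k ≤ N → 0 ≤ y → y ≤ γ → y * (k * h) ≤ υ →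
        ((k * h : ℝ), y) ∈ convexHull ℝ Sstar := by
      intro k y hk h0 hy hky
      apply subset_convexHull
      rw [hS, hO]
      exact ⟨⟨k, hk, rfl⟩, h0, hy, hky⟩
    have hbl : ((0 : ℝ), (0 : ℝ)) ∈ convexHull ℝ Sstar := by
      simpa using hvertex 0 0 (by omega) le_rfl hγ.le (by simpa using hυ.le)
    have htl : ((0 : ℝ), γ) ∈ convexHull ℝ Sstar := by
      simpa using hvertex 0 γ (by omega) hγ.le le_rfl (by simpa using hυ.le)
    have hbr : ((1 : ℝ), (0 : ℝ)) ∈ convexHull ℝ Sstar := by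
      simpa [hN] using hvertex N 0 le_rfl le_rfl hγ.le (by simpa using hυ.le)
    have htr : ((1 : ℝ), υ) ∈ convexHull ℝ Sstar := by
      simpa [hN] using hvertex N υ le_rfl hυ.le hγυ.le (by simp [hN])
    have hkink : (μm, γ) ∈ convexHull ℝ Sstar := by
      have hmh : μm = m * h := by rw [hμm, mul_comm]
      rw [hmh]
      exact hvertex m γ (by omega) hγ.le le_rfl (by rw [← hmh]; linarith)
    rintro ⟨x, y⟩ hxy
    obtain ⟨hx0, hx1, hy0, hyγ, hyx⟩ := hmem.1 hxy
    have hbot : (x, (0 : ℝ)) ∈ convexHull ℝ Sstar :=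
      hC.mk_mem_of_weights (1 - x) x (by linarith) hx0 (by linarith) hbl hbr (by ring) (by ring)
    obtain ⟨t, ht0, hyt, ht⟩ : ∃ t, 0 < t ∧ y ≤ t ∧ (x, t) ∈ convexHull ℝ Sstar := by
      rcases le_total x μm with hxm | hxm
      · refine ⟨γ, hγ, hyγ, ?_⟩
        rcases hμm0.eq_or_lt with h0 | h0
        · have : x = 0 := by linarith
          rwa [this]
        · exact hC.mk_mem_of_weights (μm - x) x (by linarith) hx0 (by linarith) htl hkink
            (by ring) (by ring)
      · refine ⟨υ + s * (1 - x), ?_, hyx, ?_⟩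
        · have := mul_nonneg hs0.le (sub_nonneg.2 hx1)
          linarith
        · exact hC.mk_mem_of_weights (1 - x) (x - μm) (by linarith) (by linarith) (by linarith)
            hkink htr (by ring) (by linear_combination (1 - x) * hsm)
    exact hC.mk_mem_of_weights (t - y) y (by linarith) hy0 (by linarith) hbot ht
      (by ring) (by ring)
end

section
/- Suppose δ < ε. Then the convex hull of S* equals Q2, i.e., conv(S*) = {(r, f) ∈ ℝ² : 0 ≤ r ≤ 1, 0 ≤ f ≤ γ, f ≤ ε·(r − μ⁻) + γ, f ≤ ((υ/μ⁺ − υ)/(μ⁺ − 1))·(r − 1) + υ}. -/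
open Finset

/-- A convex set containing the vertices of a trapezoid with vertical parallel sides and base on the
horizontal axis contains the trapezoid. -/
theorem Convex.trapezoid_mem {C : Set (ℝ × ℝ)} (hC : Convex ℝ C) {a b A B r f : ℝ} (hab : a < b)
    (ha0 : (a, 0) ∈ C) (haA : (a, A) ∈ C) (hb0 : (b, 0) ∈ C) (hbB : (b, B) ∈ C)
    (har : a ≤ r) (hrb : r ≤ b) (hf : 0 ≤ f) (hfT : f * (b - a) ≤ A * (b - r) + B * (r - a)) :
    (r, f) ∈ C := by
  have hba : 0 < b - a := sub_pos.2 hab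
  have hs : (b - r) / (b - a) + (r - a) / (b - a) = 1 := by field_simp; ring
  have h₁ : 0 ≤ (b - r) / (b - a) := div_nonneg (by linarith) hba.le
  have h₂ : 0 ≤ (r - a) / (b - a) := div_nonneg (by linarith) hba.le
  set T : ℝ := (A * (b - r) + B * (r - a)) / (b - a) with hT
  have hbot : (r, 0) ∈ C := by
    convert hC ha0 hb0 h₁ h₂ hs using 1
    ext
    · simp; field_simp; ring
    · simp
  have htop : (r, T) ∈ C := by
    convert hC haA hbB h₁ h₂ hs using 1
    ext
    · simp; field_simp; ring
    · simp [hT]; field_simp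
  have hfT' : f ≤ T := (le_div_iff₀ hba).2 hfT
  rcases hf.eq_or_lt with rfl | hf
  · exact hbot
  have hTpos : 0 < T := hf.trans_le hfT'
  have hfr : f / T ≤ 1 := (div_le_one hTpos).2 hfT'
  convert hC hbot htop (sub_nonneg.2 hfr) (by positivity) (sub_add_cancel 1 (f / T)) using 1
  ext
  · simp; ring
  · simp; field_simp

theorem stmt_1
    (n : ℕ) (hn : 0 < n)
    (γ υ : ℝ) (hυ : 0 < υ) (hγυ : υ < γ)
    (O : Set ℝ)
    (hO : O = {r : ℝ | ∃ k : ℕ, k ≤ 2 ^ (n - 1) ∧ r = (k : ℝ) * 2 ^ ((1 : ℤ) - (n : ℤ))})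
    (Sstar : Set (ℝ × ℝ))
    (hS : Sstar = {p : ℝ × ℝ | p.1 ∈ O ∧ 0 ≤ p.2 ∧ p.2 ≤ γ ∧ p.2 * p.1 ≤ υ})
    (μm μp : ℝ)
    (hμm : μm = 2 ^ ((1 : ℤ) - (n : ℤ)) * (⌊υ / (2 ^ ((1 : ℤ) - (n : ℤ)) * γ)⌋ : ℝ))
    (hμp : μp = μm + 2 ^ ((1 : ℤ) - (n : ℤ)))
    (δ ε : ℝ)
    (hδ : δ = (γ - υ) / (μm - 1))
    (hε : ε = (γ - υ / μp) / (μm - μp))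
    (Q2 : Set (ℝ × ℝ))
    (hQ2 : Q2 = {p : ℝ × ℝ | 0 ≤ p.1 ∧ p.1 ≤ 1 ∧ 0 ≤ p.2 ∧ p.2 ≤ γ ∧
      p.2 ≤ ε * (p.1 - μm) + γ ∧ p.2 ≤ ((υ / μp - υ) / (μp - 1)) * (p.1 - 1) + υ})
    (hcase : δ < ε)
    :
    convexHull ℝ Sstar = Q2 := by
  obtain ⟨h, hh⟩ : ∃ h : ℝ, h = 2 ^ ((1 : ℤ) - (n : ℤ)) := ⟨_, rfl⟩
  have hpos : 0 < h := by rw [hh]; positivity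
  have hγ : 0 < γ := hυ.trans hγυ
  have hN : ((2 ^ (n - 1) : ℕ) : ℝ) * h = 1 := by
    obtain ⟨m, rfl⟩ := Nat.exists_eq_add_of_le' hn
    have : (1 : ℤ) - ((m + 1 : ℕ) : ℤ) = -(m : ℤ) := by push_cast; ring
    rw [hh, this]
    simp
  rw [← hh] at hO hμm hμp
  obtain ⟨m, hm⟩ : ∃ m : ℕ, ⌊υ / (h * γ)⌋ = (m : ℤ) :=
    Int.eq_ofNat_of_zero_le (Int.floor_nonneg.2 (by positivity))
  have hfl := Int.floor_le (υ / (h * γ))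
  have hfu := Int.lt_floor_add_one (υ / (h * γ))
  rw [hm] at hμm hfl hfu
  push_cast at hμm hfl hfu
  rw [le_div_iff₀ (by positivity)] at hfl
  rw [div_lt_iff₀ (by positivity)] at hfu
  have hmυ : μm * γ ≤ υ := by rw [hμm]; linarith
  have hpυ : υ < μp * γ := by rw [hμp, hμm]; linarith
  have hm0 : 0 ≤ μm := by rw [hμm]; positivity
  have hmp : μm < μp := by linarith
  have hp0 : 0 < μp := by linarith
  have hm1 : μm < 1 := by
    by_contra! hcon
    nlinarith
  have hmN : m < 2 ^ (n - 1) := by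
    have : (m : ℝ) * h < ((2 ^ (n - 1) : ℕ) : ℝ) * h := by rw [hN]; linarith
    exact_mod_cast lt_of_mul_lt_mul_right this hpos.le
  have hp1 : μp ≤ 1 := by
    have : ((m + 1 : ℕ) : ℝ) * h ≤ ((2 ^ (n - 1) : ℕ) : ℝ) * h :=
      mul_le_mul_of_nonneg_right (by exact_mod_cast hmN) hpos.le
    rw [hN] at this
    push_cast at this
    linarith
  have hp1' : μp < 1 := by
    refine lt_of_le_of_ne hp1 fun hp => ?_
    rw [hδ, hε, hp, div_one] at hcase
    exact lt_irrefl _ hcase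
  have hs : (υ / μp - υ) / (μp - 1) = -(υ / μp) := by
    have : μp - 1 ≠ 0 := by linarith
    field_simp
    ring
  obtain ⟨q, hq⟩ : ∃ q : ℝ, q = υ / μp := ⟨_, rfl⟩
  have hqμ : q * μp = υ := by rw [hq]; field_simp
  rw [hs] at hQ2
  rw [← hq] at hε hQ2
  have hq0 : 0 < q := by rw [hq]; positivity
  have hqγ : q < γ := by rw [hq, div_lt_iff₀ hp0]; linarith
  have hε' : ε * (μm - μp) = γ - q := by
    rw [hε, div_mul_cancel₀ _ (by linarith)]
  have hδ' : δ * (μm - 1) = γ - υ := by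
    rw [hδ, div_mul_cancel₀ _ (by linarith)]
  have hε0 : ε < 0 := by
    by_contra! hcon
    nlinarith
  have hqε : -q < ε := by
    have h₁ : δ * (1 - μm) < ε * (1 - μm) := mul_lt_mul_of_pos_right hcase (by linarith)
    have h₂ : -q * (1 - μp) < ε * (1 - μp) := by linarith
    exact lt_of_mul_lt_mul_right h₂ (by linarith)
  have hgrid : ∀ r ∈ O, 0 ≤ r ∧ r ≤ 1 ∧ (r ≤ μm ∨ μp ≤ r) := by
    rw [hO]
    rintro r ⟨k, hk, rfl⟩
    refine ⟨by positivity, ?_, ?_⟩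
    · rw [← hN]
      exact mul_le_mul_of_nonneg_right (by exact_mod_cast hk) hpos.le
    · rcases Nat.lt_or_ge m k with hkm | hkm
      · right
        have : ((m + 1 : ℕ) : ℝ) * h ≤ k * h :=
          mul_le_mul_of_nonneg_right (by exact_mod_cast hkm) hpos.le
        push_cast at this
        linarith
      · left
        have : (k : ℝ) * h ≤ m * h :=
          mul_le_mul_of_nonneg_right (by exact_mod_cast hkm) hpos.le
        linarith
  have h0O : (0 : ℝ) ∈ O := by rw [hO]; exact ⟨0, by positivity, by simp⟩
  have h1O : (1 : ℝ) ∈ O := by rw [hO]; exact ⟨2 ^ (n - 1), le_rfl, hN.symm⟩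
  have hmO : μm ∈ O := by rw [hO]; exact ⟨m, hmN.le, by rw [hμm]; ring⟩
  have hpO : μp ∈ O := by
    rw [hO]; exact ⟨m + 1, hmN, by rw [hμp, hμm]; push_cast; ring⟩
  apply Set.Subset.antisymm
  · apply convexHull_min
    · rw [hS, hQ2]
      rintro ⟨r, f⟩ ⟨hr, hf0, hfγ, hfr⟩
      dsimp only at hr hf0 hfγ hfr
      obtain ⟨hr0, hr1, hrm | hrp⟩ := hgrid r hr
      · refine ⟨hr0, hr1, hf0, hfγ, ?_, ?_⟩ <;> dsimp only
        · linarith [mul_nonneg_of_nonpos_of_nonpos hε0.le (sub_nonpos.2 hrm)]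
        · linarith [mul_nonneg (by linarith : 0 ≤ ε + q) (sub_nonneg.2 hmp.le),
            mul_nonneg hq0.le (sub_nonneg.2 hrm)]
      · have hline : f ≤ -q * (r - 1) + υ := by
          have h₁ : f * r ≤ (-q * (r - 1) + υ) * r := by
            rw [← hqμ] at hfr ⊢
            linarith [mul_nonneg (mul_nonneg hq0.le (sub_nonneg.2 hrp)) (sub_nonneg.2 hr1)]
          exact le_of_mul_le_mul_right h₁ (by linarith)
        refine ⟨hr0, hr1, hf0, hfγ, ?_, hline⟩
        dsimp only
        linarith [mul_nonneg (by linarith : 0 ≤ ε + q) (sub_nonneg.2 hrp)]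
    · rw [hQ2]
      rintro ⟨r, f⟩ ⟨h1, h2, h3, h4, h5, h6⟩ ⟨r', f'⟩ ⟨h1', h2', h3', h4', h5', h6'⟩ a b ha hb hab
      dsimp only at *
      obtain rfl : b = 1 - a := by linarith
      refine ⟨?_, ?_, ?_, ?_, ?_, ?_⟩ <;>
        simp only [Prod.smul_mk, Prod.mk_add_mk, smul_eq_mul]
      · positivity
      · linarith [mul_le_mul_of_nonneg_left h2 ha, mul_le_mul_of_nonneg_left h2' hb]
      · positivity
      · linarith [mul_le_mul_of_nonneg_left h4 ha, mul_le_mul_of_nonneg_left h4' hb]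
      · linarith [mul_le_mul_of_nonneg_left h5 ha, mul_le_mul_of_nonneg_left h5' hb]
      · linarith [mul_le_mul_of_nonneg_left h6 ha, mul_le_mul_of_nonneg_left h6' hb]
  · have hmem : ∀ r f : ℝ, r ∈ O → 0 ≤ f → f ≤ γ → f * r ≤ υ → (r, f) ∈ convexHull ℝ Sstar := by
      intro r f h₁ h₂ h₃ h₄
      apply subset_convexHull
      rw [hS]
      exact ⟨h₁, h₂, h₃, h₄⟩
    have hbase : ∀ r ∈ O, (r, (0 : ℝ)) ∈ convexHull ℝ Sstar := fun r hr =>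
      hmem r 0 hr le_rfl hγ.le (by linarith)
    have hC := convex_convexHull ℝ Sstar
    have hmtop := hmem μm γ hmO hγ.le le_rfl (by linarith)
    have hptop := hmem μp q hpO hq0.le hqγ.le hqμ.le
    rw [hQ2]
    rintro ⟨r, f⟩ ⟨hr0, hr1, hf0, hfγ, hl₁, hl₂⟩
    dsimp only at hr0 hr1 hf0 hfγ hl₁ hl₂
    rcases lt_or_ge r μm with hrm | hrm
    · refine hC.trapezoid_mem (hr0.trans_lt hrm) (hbase 0 h0O)
        (hmem 0 γ h0O hγ.le le_rfl (by linarith)) (hbase μm hmO) hmtop hr0 hrm.le hf0 ?_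
      linarith [mul_le_mul_of_nonneg_right hfγ hm0]
    rcases le_or_gt r μp with hrp | hrp
    · refine hC.trapezoid_mem hmp (hbase μm hmO) hmtop (hbase μp hpO) hptop hrm hrp hf0 ?_
      have h₁ := mul_le_mul_of_nonneg_right hl₁ (sub_nonneg.2 hmp.le)
      have h₂ : q = γ - ε * (μm - μp) := by linarith
      rw [h₂]
      linarith
    · refine hC.trapezoid_mem hp1' (hbase μp hpO) hptop (hbase 1 h1O)
        (hmem 1 υ h1O hυ.le hγυ.le (by linarith)) hrp.le hr1 hf0 ?_
      have h₁ := mul_le_mul_of_nonneg_right hl₂ (sub_nonneg.2 hp1)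
      rw [← hqμ] at h₁ ⊢
      linarith
end

section
/- Suppose δ ≥ ε. Then every point (r, f) ∈ S* satisfies the rounding cut f ≤ δ·(r − 1) + υ; consequently S* ⊆ Q1. -/
open Finset

theorem stmt_2
    (n : ℕ) (hn : 0 < n)
    (γ υ : ℝ) (hυ : 0 < υ) (hγυ : υ < γ)
    (O : Set ℝ)
    (hO : O = {r : ℝ | ∃ k : ℕ, k ≤ 2 ^ (n - 1) ∧ r = (k : ℝ) * 2 ^ ((1 : ℤ) - (n : ℤ))})
    (Sstar : Set (ℝ × ℝ))
    (hS : Sstar = {p : ℝ × ℝ | p.1 ∈ O ∧ 0 ≤ p.2 ∧ p.2 ≤ γ ∧ p.2 * p.1 ≤ υ})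
    (μm μp : ℝ)
    (hμm : μm = 2 ^ ((1 : ℤ) - (n : ℤ)) * (⌊υ / (2 ^ ((1 : ℤ) - (n : ℤ)) * γ)⌋ : ℝ))
    (hμp : μp = μm + 2 ^ ((1 : ℤ) - (n : ℤ)))
    (δ ε : ℝ)
    (hδ : δ = (γ - υ) / (μm - 1))
    (hε : ε = (γ - υ / μp) / (μm - μp))
    (Q1 : Set (ℝ × ℝ))
    (hQ1 : Q1 = {p : ℝ × ℝ | 0 ≤ p.1 ∧ p.1 ≤ 1 ∧ 0 ≤ p.2 ∧ p.2 ≤ γ ∧ p.2 ≤ δ * (p.1 - 1) + υ})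
    (hcase : δ ≥ ε)
    :
    (∀ p ∈ Sstar, p.2 ≤ δ * (p.1 - 1) + υ) ∧ Sstar ⊆ Q1 := by
  have hh : (0 : ℝ) < 2 ^ ((1 : ℤ) - (n : ℤ)) := by positivity
  have hgrid : (2 : ℝ) ^ (n - 1) * 2 ^ ((1 : ℤ) - (n : ℤ)) = 1 := by
    rw [← zpow_natCast, ← zpow_add₀ (by norm_num), Nat.cast_sub hn]
    simp
  generalize (2 : ℝ) ^ ((1 : ℤ) - (n : ℤ)) = h at *
  have hγ : 0 < γ := hυ.trans hγυ
  have hhγ : 0 < h * γ := mul_pos hh hγ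
  have hfloor_le := (le_div_iff₀ hhγ).1 (Int.floor_le (υ / (h * γ)))
  have hlt_floor := (div_lt_iff₀ hhγ).1 (Int.lt_floor_add_one (υ / (h * γ)))
  generalize ⌊υ / (h * γ)⌋ = m at *
  have hμmγ : μm * γ ≤ υ := by rw [hμm]; linarith
  have hμpγ : υ < μp * γ := by rw [hμp, hμm]; linarith
  have hμm1 : μm < 1 := by
    by_contra! hge
    nlinarith
  have hμp0 : 0 < μp := pos_of_mul_pos_left (hυ.trans hμpγ) hγ.le
  have hμp1 : μp ≤ 1 := by
    have hm : m < 2 ^ (n - 1) := by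
      have : (m : ℝ) < 2 ^ (n - 1) :=
        lt_of_mul_lt_mul_right (by linarith : (m : ℝ) * h < 2 ^ (n - 1) * h) hh.le
      exact_mod_cast this
    have hm' : (m : ℝ) + 1 ≤ 2 ^ (n - 1) := by exact_mod_cast hm
    have := mul_le_mul_of_nonneg_right hm' hh.le
    rw [hμp, hμm]
    linarith
  have hδ_neg : δ < 0 := hδ ▸ div_neg_of_pos_of_neg (by linarith) (by linarith)
  have hδ_line : δ * (μm - 1) = γ - υ := by
    rw [hδ]
    exact div_mul_cancel₀ _ (by linarith)
  have hε_line : ε * (μm - μp) = γ - υ / μp := by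
    rw [hε]
    exact div_mul_cancel₀ _ (by linarith)
  have hcut_μp : υ / μp ≤ δ * (μp - 1) + υ := by nlinarith
  rw [div_le_iff₀ hμp0] at hcut_μp
  have hrange : ∀ r ∈ O, 0 ≤ r ∧ r ≤ 1 ∧ (r ≤ μm ∨ μp ≤ r) := by
    intro r hr
    rw [hO] at hr
    obtain ⟨k, hk, rfl⟩ := hr
    have hk' : (k : ℝ) ≤ 2 ^ (n - 1) := by exact_mod_cast hk
    refine ⟨by positivity, hgrid ▸ mul_le_mul_of_nonneg_right hk' hh.le, ?_⟩
    rcases le_or_gt (k : ℤ) m with hkm | hkm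
    · left
      have : (k : ℝ) ≤ m := by exact_mod_cast hkm
      rw [hμm, mul_comm h]
      exact mul_le_mul_of_nonneg_right this hh.le
    · right
      have : (m : ℝ) + 1 ≤ k := by exact_mod_cast hkm
      have := mul_le_mul_of_nonneg_right this hh.le
      rw [hμp, hμm]
      linarith
  have hcut : ∀ p ∈ Sstar, p.2 ≤ δ * (p.1 - 1) + υ := by
    rintro ⟨r, f⟩ hp
    rw [hS] at hp
    obtain ⟨hr, -, hfγ, hfr⟩ := hp
    obtain ⟨-, hr1, hrμ⟩ := hrange r hr
    dsimp only at *
    rcases hrμ with hrμ | hrμ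
    · nlinarith
    · have hr0 : 0 < r := hμp0.trans_le hrμ
      refine le_of_mul_le_mul_right (hfr.trans ?_) hr0
      rcases hr1.eq_or_lt with rfl | hr1
      · simp
      · have hslope : υ ≤ -δ * μp := by
          refine le_of_mul_le_mul_left (a := 1 - μp) ?_ (by linarith)
          linarith
        have hslope' : υ ≤ -δ * r :=
          hslope.trans (mul_le_mul_of_nonneg_left hrμ (by linarith))
        nlinarith
  refine ⟨hcut, fun p hp => ?_⟩
  have hp_cut := hcut p hp
  rw [hS] at hp
  rw [hQ1]
  obtain ⟨hr, hf0, hfγ, -⟩ := hp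
  obtain ⟨hr0, hr1, -⟩ := hrange p.1 hr
  exact ⟨hr0, hr1, hf0, hfγ, hp_cut⟩
end

section
/- Suppose δ ≥ ε. Then every point of Q1 is a convex combination of points of S*, i.e., Q1 ⊆ conv(S*). -/
open Finset

/-- A convex set containing `(r, 0)` and `(r, L)` contains every `(r, f)` with `0 ≤ f ≤ L`. -/
theorem Convex.mem_of_vertical {K : Set (ℝ × ℝ)} (hK : Convex ℝ K) {r f L : ℝ} (hL : 0 < L)
    (hf : 0 ≤ f) (hfL : f ≤ L) (h₀ : (r, (0 : ℝ)) ∈ K) (h₁ : (r, L) ∈ K) : (r, f) ∈ K := by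
  have h := hK h₀ h₁ (sub_nonneg.2 ((div_le_one hL).2 hfL)) (div_nonneg hf hL.le)
    (sub_add_cancel 1 (f / L))
  convert h using 1
  ext
  · simp only [Prod.fst_add, Prod.smul_fst, smul_eq_mul]
    ring
  · simp only [Prod.snd_add, Prod.smul_snd, smul_eq_mul]
    field_simp
    ring

/-- The part of a strip lying under the horizontal line at height `γ` and under the line through
`(m, γ)` and `(1, υ)` is contained in any convex set containing its five corners. -/
theorem Convex.mem_of_corners {K : Set (ℝ × ℝ)} (hK : Convex ℝ K) {m γ υ r f : ℝ}
    (hm : 0 ≤ m) (hm1 : m < 1) (hυ : 0 < υ) (hγ : 0 < γ)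
    (h00 : ((0 : ℝ), (0 : ℝ)) ∈ K) (h10 : ((1 : ℝ), (0 : ℝ)) ∈ K) (h0γ : ((0 : ℝ), γ) ∈ K)
    (hmγ : (m, γ) ∈ K) (h1υ : ((1 : ℝ), υ) ∈ K)
    (hr : 0 ≤ r) (hr1 : r ≤ 1) (hf : 0 ≤ f) (hfγ : f ≤ γ)
    (hfl : f ≤ (γ - υ) / (m - 1) * (r - 1) + υ) : (r, f) ∈ K := by
  have hr0 : (r, (0 : ℝ)) ∈ K := by
    have h := hK h00 h10 (sub_nonneg.2 hr1) hr (sub_add_cancel 1 r)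
    simpa using h
  rcases le_or_gt r m with hrm | hrm
  · refine hK.mem_of_vertical hγ hf hfγ hr0 ?_
    rcases hm.eq_or_lt with rfl | hm0
    · rwa [le_antisymm hrm hr]
    have h := hK h0γ hmγ (sub_nonneg.2 ((div_le_one hm0).2 hrm)) (div_nonneg hr hm)
      (sub_add_cancel 1 (r / m))
    convert h using 1
    ext
    · simp [hm0.ne']
    · simp only [Prod.snd_add, Prod.smul_snd, smul_eq_mul]
      ring
  · have hd : 0 < 1 - m := sub_pos.2 hm1
    have ht0 : 0 ≤ (r - m) / (1 - m) := div_nonneg (sub_nonneg.2 hrm.le) hd.le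
    have ht1 : 0 ≤ (1 - r) / (1 - m) := div_nonneg (sub_nonneg.2 hr1) hd.le
    have hsum : (1 - r) / (1 - m) + (r - m) / (1 - m) = 1 := by
      field_simp
      ring
    have hline : (γ - υ) / (m - 1) * (r - 1) + υ
        = (1 - r) / (1 - m) * γ + (r - m) / (1 - m) * υ := by
      have hd' : m - 1 ≠ 0 := (sub_neg.2 hm1).ne
      field_simp
      ring
    have hpos : 0 < (1 - r) / (1 - m) * γ + (r - m) / (1 - m) * υ :=
      add_pos_of_nonneg_of_pos (mul_nonneg ht1 hγ.le) (mul_pos (div_pos (sub_pos.2 hrm) hd) hυ)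
    refine hK.mem_of_vertical hpos hf (hline ▸ hfl) hr0 ?_
    have h := hK hmγ h1υ ht1 ht0 hsum
    convert h using 1
    ext
    · simp only [Prod.fst_add, Prod.smul_fst, smul_eq_mul]
      field_simp
      ring
    · simp

theorem stmt_3
    (n : ℕ) (hn : 0 < n)
    (γ υ : ℝ) (hυ : 0 < υ) (hγυ : υ < γ)
    (O : Set ℝ)
    (hO : O = {r : ℝ | ∃ k : ℕ, k ≤ 2 ^ (n - 1) ∧ r = (k : ℝ) * 2 ^ ((1 : ℤ) - (n : ℤ))})
    (Sstar : Set (ℝ × ℝ))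
    (hS : Sstar = {p : ℝ × ℝ | p.1 ∈ O ∧ 0 ≤ p.2 ∧ p.2 ≤ γ ∧ p.2 * p.1 ≤ υ})
    (μm μp : ℝ)
    (hμm : μm = 2 ^ ((1 : ℤ) - (n : ℤ)) * (⌊υ / (2 ^ ((1 : ℤ) - (n : ℤ)) * γ)⌋ : ℝ))
    (hμp : μp = μm + 2 ^ ((1 : ℤ) - (n : ℤ)))
    (δ ε : ℝ)
    (hδ : δ = (γ - υ) / (μm - 1))
    (hε : ε = (γ - υ / μp) / (μm - μp))
    (Q1 : Set (ℝ × ℝ))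
    (hQ1 : Q1 = {p : ℝ × ℝ | 0 ≤ p.1 ∧ p.1 ≤ 1 ∧ 0 ≤ p.2 ∧ p.2 ≤ γ ∧ p.2 ≤ δ * (p.1 - 1) + υ})
    (hcase : δ ≥ ε)
    :
    Q1 ⊆ convexHull ℝ Sstar := by
  have hγ : 0 < γ := hυ.trans hγυ
  set h : ℝ := 2 ^ ((1 : ℤ) - (n : ℤ)) with hh
  have hpos : 0 < h := by positivity
  have hN : ((2 ^ (n - 1) : ℕ) : ℝ) * h = 1 := by
    rw [hh, Nat.cast_pow, Nat.cast_ofNat, ← zpow_natCast, ← zpow_add₀ two_ne_zero,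
      Nat.cast_sub hn]
    simp
  have hfloor : 0 ≤ ⌊υ / (h * γ)⌋ := Int.floor_nonneg.2 (by positivity)
  obtain ⟨k, hk⟩ := Int.eq_ofNat_of_zero_le hfloor
  have hμk : μm = (k : ℝ) * h := by
    rw [hμm, hk, mul_comm]
    simp
  have hμγ : γ * μm ≤ υ := by
    have hle := Int.floor_le (υ / (h * γ))
    rw [le_div_iff₀ (by positivity)] at hle
    rw [hμm]
    linarith
  have hμ0 : 0 ≤ μm := by rw [hμk]; positivity
  have hμ1 : μm < 1 := by
    by_contra! hcon
    nlinarith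
  have hkN : k ≤ 2 ^ (n - 1) := by
    have hlt : (k : ℝ) * h < ((2 ^ (n - 1) : ℕ) : ℝ) * h := by rwa [hN, ← hμk]
    exact_mod_cast (lt_of_mul_lt_mul_right hlt hpos.le).le
  have h0O : (0 : ℝ) ∈ O := hO ▸ ⟨0, Nat.zero_le _, by simp⟩
  have h1O : (1 : ℝ) ∈ O := hO ▸ ⟨2 ^ (n - 1), le_rfl, hN.symm⟩
  have hmO : μm ∈ O := hO ▸ ⟨k, hkN, hμk⟩
  have hmem : ∀ {r f : ℝ}, r ∈ O → 0 ≤ f → f ≤ γ → f * r ≤ υ → (r, f) ∈ convexHull ℝ Sstar :=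
    fun hr hf hfγ hfr => subset_convexHull ℝ Sstar (hS ▸ ⟨hr, hf, hfγ, hfr⟩)
  rintro ⟨r, f⟩ hp
  rw [hQ1] at hp
  obtain ⟨hr, hr1, hf, hfγ, hfl⟩ := hp
  exact (convex_convexHull ℝ Sstar).mem_of_corners hμ0 hμ1 hυ hγ
    (hmem h0O le_rfl hγ.le (by simpa using hυ.le)) (hmem h1O le_rfl hγ.le (by simpa using hυ.le))
    (hmem h0O hγ.le le_rfl (by simpa using hυ.le)) (hmem hmO hγ.le le_rfl hμγ)
    (hmem h1O hυ.le hγυ.le (by simp)) hr hr1 hf hfγ (hδ ▸ hfl)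
end

section
/- Suppose δ < ε. Then every point (r, f) ∈ S* satisfies both rounding cuts f ≤ ε·(r − μ⁻) + γ and f ≤ ((υ/μ⁺ − υ)/(μ⁺ − 1))·(r − 1) + υ; consequently S* ⊆ Q2. -/
open Finset

theorem stmt_4
    (n : ℕ) (hn : 0 < n)
    (γ υ : ℝ) (hυ : 0 < υ) (hγυ : υ < γ)
    (O : Set ℝ)
    (hO : O = {r : ℝ | ∃ k : ℕ, k ≤ 2 ^ (n - 1) ∧ r = (k : ℝ) * 2 ^ ((1 : ℤ) - (n : ℤ))})
    (Sstar : Set (ℝ × ℝ))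
    (hS : Sstar = {p : ℝ × ℝ | p.1 ∈ O ∧ 0 ≤ p.2 ∧ p.2 ≤ γ ∧ p.2 * p.1 ≤ υ})
    (μm μp : ℝ)
    (hμm : μm = 2 ^ ((1 : ℤ) - (n : ℤ)) * (⌊υ / (2 ^ ((1 : ℤ) - (n : ℤ)) * γ)⌋ : ℝ))
    (hμp : μp = μm + 2 ^ ((1 : ℤ) - (n : ℤ)))
    (δ ε : ℝ)
    (hδ : δ = (γ - υ) / (μm - 1))
    (hε : ε = (γ - υ / μp) / (μm - μp))
    (Q2 : Set (ℝ × ℝ))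
    (hQ2 : Q2 = {p : ℝ × ℝ | 0 ≤ p.1 ∧ p.1 ≤ 1 ∧ 0 ≤ p.2 ∧ p.2 ≤ γ ∧
      p.2 ≤ ε * (p.1 - μm) + γ ∧ p.2 ≤ ((υ / μp - υ) / (μp - 1)) * (p.1 - 1) + υ})
    (hcase : δ < ε)
    :
    (∀ p ∈ Sstar, p.2 ≤ ε * (p.1 - μm) + γ ∧ p.2 ≤ ((υ / μp - υ) / (μp - 1)) * (p.1 - 1) + υ) ∧ Sstar ⊆ Q2 := by
  have hs : (0 : ℝ) < 2 ^ ((1 : ℤ) - (n : ℤ)) := by positivity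
  have hγ : 0 < γ := hυ.trans hγυ
  have hpow : (2 : ℝ) ^ (n - 1) * 2 ^ ((1 : ℤ) - (n : ℤ)) = 1 := by
    rw [← zpow_natCast, ← zpow_add₀ (two_ne_zero), Nat.cast_sub hn]
    simp
  generalize (2 : ℝ) ^ ((1 : ℤ) - (n : ℤ)) = s at *
  have hfl := Int.floor_le (υ / (s * γ))
  have hlt := Int.lt_floor_add_one (υ / (s * γ))
  have hm0 : 0 ≤ ⌊υ / (s * γ)⌋ := Int.floor_nonneg.2 (by positivity)
  generalize ⌊υ / (s * γ)⌋ = m at *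
  rw [le_div_iff₀ (by positivity)] at hfl
  rw [div_lt_iff₀ (by positivity)] at hlt
  have hm0' : (0 : ℝ) ≤ m := by exact_mod_cast hm0
  have hμm0 : 0 ≤ μm := by rw [hμm]; positivity
  have hp0 : 0 < μp := by linarith
  have hμm1 : μm < 1 := by
    have : μm * γ ≤ υ := by rw [hμm]; linarith
    by_contra! h
    nlinarith
  have hp1 : μp ≤ 1 := by
    have h1 : (m : ℝ) < 2 ^ (n - 1) := by
      have : s * m < s * 2 ^ (n - 1) := by linarith
      exact lt_of_mul_lt_mul_left this hs.le
    have h2 : m + 1 ≤ 2 ^ (n - 1) := by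
      have : m < 2 ^ (n - 1) := by exact_mod_cast h1
      omega
    have h3 : (m : ℝ) + 1 ≤ 2 ^ (n - 1) := by exact_mod_cast h2
    have := mul_le_mul_of_nonneg_left h3 hs.le
    linarith
  obtain ⟨a, ha⟩ : ∃ a, a = υ / μp := ⟨_, rfl⟩
  have hap : υ = a * μp := by rw [ha]; field_simp
  have ha0 : 0 < a := by rw [ha]; positivity
  have haγ : a < γ := by
    rw [ha, div_lt_iff₀ hp0, hμp, hμm]
    linarith
  rw [← ha] at hε hQ2 ⊢
  have hεs : γ = a - ε * s := by
    have : μm - μp ≠ 0 := by linarith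
    have h := (eq_div_iff this).1 hε
    have hd : μm - μp = -s := by linarith
    rw [hd] at h
    linarith
  have hε0 : ε < 0 := by
    by_contra! h
    have := mul_nonneg h hs.le
    linarith
  have hprod : 0 < (a + ε) * (1 - μp) := by
    rw [hδ, div_lt_iff_of_neg (by linarith)] at hcase
    have hd : μm = μp - s := by linarith
    rw [hd, hεs, hap] at hcase
    linarith
  have hp1' : μp < 1 := by
    refine lt_of_le_of_ne hp1 fun h => ?_
    simp [h] at hprod
  have hεa : 0 < a + ε := pos_of_mul_pos_left hprod (by linarith)
  have hslope : (a - υ) / (μp - 1) = -a := by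
    rw [div_eq_iff (by linarith), hap]
    ring
  rw [hslope] at hQ2 ⊢
  have hO01 : ∀ r ∈ O, 0 ≤ r ∧ r ≤ 1 ∧ (r ≤ μm ∨ μp ≤ r) := by
    rw [hO]
    rintro r ⟨k, hk, rfl⟩
    have hk' : (k : ℝ) ≤ 2 ^ (n - 1) := by exact_mod_cast hk
    refine ⟨by positivity, (mul_le_mul_of_nonneg_right hk' hs.le).trans_eq hpow, ?_⟩
    rcases le_or_gt (k : ℤ) m with h | h
    · left
      have h' : (k : ℝ) ≤ m := by exact_mod_cast h
      have := mul_le_mul_of_nonneg_right h' hs.le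
      linarith
    · right
      have h' : (m : ℝ) + 1 ≤ k := by exact_mod_cast h
      have := mul_le_mul_of_nonneg_right h' hs.le
      linarith
  have hcuts : ∀ p ∈ Sstar, p.2 ≤ ε * (p.1 - μm) + γ ∧ p.2 ≤ -a * (p.1 - 1) + υ := by
    rw [hS]
    rintro ⟨r, f⟩ ⟨hr, hf0, hfγ, hfr⟩
    obtain ⟨hr0, hr1, hr | hr⟩ := hO01 r hr
    · dsimp only at *
      have h1 := mul_nonneg_of_nonpos_of_nonpos hε0.le (sub_nonpos.2 hr)
      have h2 := mul_nonneg hεa.le hs.le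
      have h3 := mul_nonneg ha0.le (sub_nonneg.2 hr)
      have hd : μm = μp - s := by linarith
      rw [hd] at h3
      constructor <;> linarith
    · dsimp only at *
      have hr0' : 0 < r := hp0.trans_le hr
      have hd : μm = μp - s := by linarith
      have hεr : 0 ≤ a + ε * r := by nlinarith
      have h1 := mul_nonneg (sub_nonneg.2 hr) hεr
      have h2 := mul_nonneg (mul_nonneg ha0.le (sub_nonneg.2 hr)) (sub_nonneg.2 hr1)
      rw [hap] at hfr
      constructor
      · refine le_of_mul_le_mul_right ?_ hr0'
        rw [hd, hεs]
        linarith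
      · refine le_of_mul_le_mul_right ?_ hr0'
        rw [hap]
        linarith
  refine ⟨hcuts, fun p hp => ?_⟩
  have hc := hcuts p hp
  rw [hS] at hp
  obtain ⟨hr, hf0, hfγ, -⟩ := hp
  rw [hQ2]
  exact ⟨(hO01 _ hr).1, (hO01 _ hr).2.1, hf0, hfγ, hc.1, hc.2⟩
end

section
/- Suppose δ ≥ ε. Then the polyhedron Q1 equals the convex hull of the five points P1 = (0, 0), P2 = (0, γ), P3 = (μ⁻, γ), P4 = (1, υ), P5 = (1, 0). -/
open Finset

/-- A convex set in the plane containing two points on a vertical line contains the points between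
them. -/
lemma Convex.vertical_mem {C : Set (ℝ × ℝ)} (hC : Convex ℝ C) {r T f : ℝ} (hT : 0 < T)
    (hb : (r, (0 : ℝ)) ∈ C) (ht : (r, T) ∈ C) (hf0 : 0 ≤ f) (hfT : f ≤ T) : (r, f) ∈ C := by
  have key := hC hb ht (sub_nonneg.2 ((div_le_one hT).2 hfT)) (div_nonneg hf0 hT.le)
    (sub_add_cancel 1 (f / T))
  convert key using 1
  ext
  · simp only [Prod.fst_add, Prod.smul_fst, smul_eq_mul]
    ring
  · simp only [Prod.snd_add, Prod.smul_snd, smul_eq_mul]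
    field_simp
    ring

/-- The rectangle `[0, 1] × [0, γ]` with its upper right corner cut off is the convex hull of its vertices. -/
lemma cut_rectangle_eq_convexHull {γ υ m : ℝ} (hυ : 0 < υ) (hγυ : υ < γ) (hm0 : 0 ≤ m)
    (hm1 : m < 1) :
    {p : ℝ × ℝ | 0 ≤ p.1 ∧ p.1 ≤ 1 ∧ 0 ≤ p.2 ∧ p.2 ≤ γ ∧
      p.2 ≤ (γ - υ) / (m - 1) * (p.1 - 1) + υ} =
      convexHull ℝ ({(0, 0), (0, γ), (m, γ), (1, υ), (1, 0)} : Set (ℝ × ℝ)) := by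
  have hm : m - 1 < 0 := by linarith
  have hδ : (γ - υ) / (m - 1) * (m - 1) = γ - υ := div_mul_cancel₀ _ hm.ne
  have hδ0 : (γ - υ) / (m - 1) < 0 := div_neg_of_pos_of_neg (by linarith) hm
  set d := (γ - υ) / (m - 1) with hd
  apply Set.Subset.antisymm
  · rintro ⟨r, f⟩ ⟨hr0, hr1, hf0, hfγ, hf⟩
    dsimp only at hr0 hr1 hf0 hfγ hf
    set S : Set (ℝ × ℝ) := {(0, 0), (0, γ), (m, γ), (1, υ), (1, 0)} with hS
    have hC : Convex ℝ (convexHull ℝ S) := convex_convexHull ℝ S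
    have h1 : ((0 : ℝ), (0 : ℝ)) ∈ convexHull ℝ S := subset_convexHull ℝ S (by simp [hS])
    have h2 : ((0 : ℝ), γ) ∈ convexHull ℝ S := subset_convexHull ℝ S (by simp [hS])
    have h3 : (m, γ) ∈ convexHull ℝ S := subset_convexHull ℝ S (by simp [hS])
    have h4 : ((1 : ℝ), υ) ∈ convexHull ℝ S := subset_convexHull ℝ S (by simp [hS])
    have h5 : ((1 : ℝ), (0 : ℝ)) ∈ convexHull ℝ S := subset_convexHull ℝ S (by simp [hS])
    have hb : (r, (0 : ℝ)) ∈ convexHull ℝ S := by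
      simpa using hC h1 h5 (sub_nonneg.2 hr1) hr0 (sub_add_cancel 1 r)
    rcases le_or_gt r m with hrm | hrm
    · refine hC.vertical_mem (hυ.trans hγυ) hb ?_ hf0 hfγ
      rcases hm0.eq_or_lt with rfl | hm_pos
      · rwa [le_antisymm hrm hr0]
      · convert hC h2 h3 (sub_nonneg.2 ((div_le_one hm_pos).2 hrm)) (div_nonneg hr0 hm_pos.le)
          (sub_add_cancel 1 (r / m)) using 1
        ext
        · simp [hm_pos.ne']
        · simp only [Prod.snd_add, Prod.smul_snd, smul_eq_mul]
          ring
    · refine hC.vertical_mem (T := d * (r - 1) + υ) (by nlinarith) hb ?_ hf0 hf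
      have hm' : 0 < 1 - m := by linarith
      convert hC h3 h4 (div_nonneg (sub_nonneg.2 hr1) hm'.le) (div_nonneg (sub_nonneg.2 hrm.le) hm'.le)
        (by field_simp; ring) using 1
      ext
      · simp only [Prod.fst_add, Prod.smul_fst, smul_eq_mul]
        field_simp
        ring
      · simp only [Prod.snd_add, Prod.smul_snd, smul_eq_mul]
        field_simp
        linear_combination (1 - r) * hδ
  · refine convexHull_min ?_ ?_
    · rintro p (rfl | rfl | rfl | rfl | rfl) <;> refine ⟨?_, ?_, ?_, ?_, ?_⟩ <;> dsimp only <;>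
        nlinarith
    · rintro ⟨x, y⟩ ⟨hx0, hx1, hy0, hyγ, hy⟩ ⟨z, w⟩ ⟨hz0, hz1, hw0, hwγ, hw⟩ a b ha hb hab
      dsimp only at *
      obtain rfl : b = 1 - a := by linarith
      refine ⟨?_, ?_, ?_, ?_, ?_⟩ <;>
        simp only [Prod.fst_add, Prod.snd_add, Prod.smul_fst, Prod.smul_snd, smul_eq_mul]
      · positivity
      · nlinarith
      · positivity
      · nlinarith
      · linear_combination a * hy + (1 - a) * hw

theorem stmt_6
    (n : ℕ) (hn : 0 < n)
    (γ υ : ℝ) (hυ : 0 < υ) (hγυ : υ < γ)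
    (μm μp : ℝ)
    (hμm : μm = 2 ^ ((1 : ℤ) - (n : ℤ)) * (⌊υ / (2 ^ ((1 : ℤ) - (n : ℤ)) * γ)⌋ : ℝ))
    (hμp : μp = μm + 2 ^ ((1 : ℤ) - (n : ℤ)))
    (δ ε : ℝ)
    (hδ : δ = (γ - υ) / (μm - 1))
    (hε : ε = (γ - υ / μp) / (μm - μp))
    (Q1 : Set (ℝ × ℝ))
    (hQ1 : Q1 = {p : ℝ × ℝ | 0 ≤ p.1 ∧ p.1 ≤ 1 ∧ 0 ≤ p.2 ∧ p.2 ≤ γ ∧ p.2 ≤ δ * (p.1 - 1) + υ})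
    (hcase : δ ≥ ε)
    :
    Q1 = convexHull ℝ ({(0, 0), (0, γ), (μm, γ), (1, υ), (1, 0)} : Set (ℝ × ℝ)) := by
  have hγ : 0 < γ := hυ.trans hγυ
  have hh : (0 : ℝ) < 2 ^ ((1 : ℤ) - (n : ℤ)) := by positivity
  generalize (2 : ℝ) ^ ((1 : ℤ) - (n : ℤ)) = h at hμm hh
  have hm0 : 0 ≤ μm := by
    rw [hμm]
    exact mul_nonneg hh.le (Int.cast_nonneg (Int.floor_nonneg.2 (by positivity)))
  have hm1 : μm < 1 := by
    calc μm ≤ h * (υ / (h * γ)) := hμm ▸ mul_le_mul_of_nonneg_left (Int.floor_le _) hh.le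
      _ = υ / γ := by field_simp
      _ < 1 := (div_lt_one hγ).2 hγυ
  rw [hQ1, hδ]
  exact cut_rectangle_eq_convexHull hυ hγυ hm0 hm1
end

section
/- Suppose δ < ε. Then the polyhedron Q2 equals the convex hull of the six points P1 = (0, 0), P2 = (0, γ), P3 = (μ⁻, γ), P6 = (μ⁺, υ/μ⁺), P4 = (1, υ), P5 = (1, 0). -/
open Finset

/-- A convex set containing the endpoints of a segment of slope `s` contains the point of the
segment with abscissa `r`. -/
theorem Convex.mem_of_slope {S : Set (ℝ × ℝ)} (hS : Convex ℝ S) {x₀ y₀ x₁ y₁ s r y : ℝ}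
    (h₀ : (x₀, y₀) ∈ S) (h₁ : (x₁, y₁) ∈ S) (hy₁ : y₁ = y₀ + s * (x₁ - x₀))
    (hr₀ : x₀ ≤ r) (hr₁ : r ≤ x₁) (hy : y = y₀ + s * (r - x₀)) : (r, y) ∈ S := by
  obtain ⟨a, b, ha, hb, hab, rfl⟩ : r ∈ segment ℝ x₀ x₁ := by
    rw [segment_eq_Icc (hr₀.trans hr₁)]
    exact ⟨hr₀, hr₁⟩
  convert hS h₀ h₁ ha hb hab using 1
  obtain rfl : a = 1 - b := by linarith
  ext
  · simp
  · simp only [smul_eq_mul, Prod.snd_add, Prod.smul_snd, hy, hy₁]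
    ring

/-- A convex set containing two points of a vertical line contains the points between them. -/
theorem Convex.mem_of_vertical_s7 {S : Set (ℝ × ℝ)} (hS : Convex ℝ S) {r y₀ y₁ y : ℝ}
    (h₀ : (r, y₀) ∈ S) (h₁ : (r, y₁) ∈ S) (hy₀ : y₀ ≤ y) (hy₁ : y ≤ y₁) : (r, y) ∈ S := by
  obtain ⟨a, b, ha, hb, hab, rfl⟩ : y ∈ segment ℝ y₀ y₁ := by
    rw [segment_eq_Icc (hy₀.trans hy₁)]
    exact ⟨hy₀, hy₁⟩
  convert hS h₀ h₁ ha hb hab using 1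
  ext
  · simp [← add_mul, hab]
  · simp

/-- The half-plane below a non-vertical line is convex. -/
theorem convex_setOf_snd_le (m c d : ℝ) :
    Convex ℝ {p : ℝ × ℝ | p.2 ≤ m * (p.1 - c) + d} := by
  rintro ⟨x, y⟩ hp ⟨x', y'⟩ hq a b ha hb hab
  simp only [Set.mem_ofPred_eq, Prod.snd_add, Prod.fst_add, Prod.smul_fst, Prod.smul_snd,
    smul_eq_mul] at *
  obtain rfl : a = 1 - b := by linarith
  nlinarith [mul_le_mul_of_nonneg_left hp ha, mul_le_mul_of_nonneg_left hq hb]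

/-- The region under two lines meeting above `b`, inside the box `[0, 1] × [0, γ]`, is the convex
hull of its six vertices. -/
theorem polygon_eq_convexHull {a b w γ υ m s : ℝ} (ha : 0 ≤ a) (hab : a < b) (hb : b < 1)
    (hυ : 0 ≤ υ) (hυw : υ ≤ w) (hwγ : w ≤ γ) (hm : w = γ + m * (b - a))
    (hs : υ = w + s * (1 - b)) (hsm : s ≤ m) :
    {p : ℝ × ℝ | 0 ≤ p.1 ∧ p.1 ≤ 1 ∧ 0 ≤ p.2 ∧ p.2 ≤ γ ∧
      p.2 ≤ m * (p.1 - a) + γ ∧ p.2 ≤ s * (p.1 - 1) + υ} =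
    convexHull ℝ ({(0, 0), (0, γ), (a, γ), (b, w), (1, υ), (1, 0)} : Set (ℝ × ℝ)) := by
  have hm0 : m ≤ 0 := by
    by_contra! h
    nlinarith [mul_pos h (sub_pos.2 hab)]
  have hs0 : s ≤ 0 := hsm.trans hm0
  apply Set.Subset.antisymm
  · rintro ⟨r, f⟩ ⟨hr0, hr1, hf0, hfγ, hfm, hfs⟩
    simp only at hr0 hr1 hf0 hfγ hfm hfs
    have hS := convex_convexHull ℝ
      ({(0, 0), (0, γ), (a, γ), (b, w), (1, υ), (1, 0)} : Set (ℝ × ℝ))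
    have hV := subset_convexHull ℝ
      ({(0, 0), (0, γ), (a, γ), (b, w), (1, υ), (1, 0)} : Set (ℝ × ℝ))
    generalize convexHull ℝ
      ({(0, 0), (0, γ), (a, γ), (b, w), (1, υ), (1, 0)} : Set (ℝ × ℝ)) = S at hS hV ⊢
    simp only [Set.insert_subset_iff, Set.singleton_subset_iff] at hV
    obtain ⟨h1, h2, h3, h6, h4, h5⟩ := hV
    have hbase : (r, 0) ∈ S := hS.mem_of_slope (s := 0) h1 h5 (by ring) hr0 hr1 (by ring)
    rcases le_total r a with hra | hra
    · exact hS.mem_of_vertical_s7 hbase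
        (hS.mem_of_slope (s := 0) h2 h3 (by ring) hr0 hra rfl) hf0 (by linarith)
    · rcases le_total r b with hrb | hrb
      · exact hS.mem_of_vertical_s7 hbase (hS.mem_of_slope h3 h6 hm hra hrb rfl) hf0 (by linarith)
      · exact hS.mem_of_vertical_s7 hbase (hS.mem_of_slope h6 h4 hs hrb hr1 rfl) hf0 (by linarith)
  · refine convexHull_min ?_ ?_
    · simp only [Set.insert_subset_iff, Set.singleton_subset_iff, Set.mem_ofPred_eq]
      have hma : 0 ≤ -m * a := mul_nonneg (by linarith) ha
      have hba : 0 ≤ (m - s) * (b - a) := mul_nonneg (by linarith) (by linarith)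
      have hsa : 0 ≤ -s * a := mul_nonneg (by linarith) ha
      have hmb : 0 ≤ (m - s) * (1 - b) := mul_nonneg (by linarith) (by linarith)
      refine ⟨?_, ?_, ?_, ?_, ?_, ?_⟩ <;> refine ⟨?_, ?_, ?_, ?_, ?_, ?_⟩ <;> nlinarith
    · have hbox := (convex_Icc (𝕜 := ℝ) (0 : ℝ) 1).prod (convex_Icc (𝕜 := ℝ) (0 : ℝ) γ)
      have hQ := hbox.inter ((convex_setOf_snd_le m a γ).inter (convex_setOf_snd_le s 1 υ))
      refine (congrArg (Convex ℝ) (Set.ext fun p ↦ ?_)).mp hQ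
      simp only [Set.mem_ofPred_eq, Set.mem_inter_iff, Set.mem_prod, Set.mem_Icc]
      tauto

theorem stmt_7
    (n : ℕ) (hn : 0 < n)
    (γ υ : ℝ) (hυ : 0 < υ) (hγυ : υ < γ)
    (μm μp : ℝ)
    (hμm : μm = 2 ^ ((1 : ℤ) - (n : ℤ)) * (⌊υ / (2 ^ ((1 : ℤ) - (n : ℤ)) * γ)⌋ : ℝ))
    (hμp : μp = μm + 2 ^ ((1 : ℤ) - (n : ℤ)))
    (δ ε : ℝ)
    (hδ : δ = (γ - υ) / (μm - 1))
    (hε : ε = (γ - υ / μp) / (μm - μp))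
    (Q2 : Set (ℝ × ℝ))
    (hQ2 : Q2 = {p : ℝ × ℝ | 0 ≤ p.1 ∧ p.1 ≤ 1 ∧ 0 ≤ p.2 ∧ p.2 ≤ γ ∧
      p.2 ≤ ε * (p.1 - μm) + γ ∧ p.2 ≤ ((υ / μp - υ) / (μp - 1)) * (p.1 - 1) + υ})
    (hcase : δ < ε)
    :
    Q2 = convexHull ℝ ({(0, 0), (0, γ), (μm, γ), (μp, υ / μp), (1, υ), (1, 0)} : Set (ℝ × ℝ)) := by
  have hγ : 0 < γ := hυ.trans hγυ
  set h : ℝ := 2 ^ ((1 : ℤ) - (n : ℤ)) with hh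
  have hpos : 0 < h := by positivity
  have hhN : h * (2 ^ (n - 1) : ℕ) = 1 := by
    push_cast
    rw [hh, ← zpow_natCast, ← zpow_add₀ two_ne_zero, Nat.cast_sub hn]
    simp
  set k : ℤ := ⌊υ / (h * γ)⌋ with hk
  have hk0 : 0 ≤ k := Int.floor_nonneg.2 (by positivity)
  have hμm0 : 0 ≤ μm := by
    rw [hμm]
    exact mul_nonneg hpos.le (by exact_mod_cast hk0)
  have hmp : μm < μp := by linarith
  have hμp0 : 0 < μp := hμm0.trans_lt hmp
  have hk1 : υ < γ * μp := by
    have := (div_lt_iff₀ (mul_pos hpos hγ)).1 (Int.lt_floor_add_one (υ / (h * γ)))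
    rw [hμp, hμm]
    linarith
  have hkN : k < (2 ^ (n - 1) : ℕ) := by
    rw [hk, Int.floor_lt, div_lt_iff₀ (mul_pos hpos hγ), Int.cast_natCast, ← mul_assoc,
      mul_comm _ h, hhN]
    linarith
  have hμp1 : μp ≤ 1 := by
    have : (k : ℝ) + 1 ≤ (2 ^ (n - 1) : ℕ) := by exact_mod_cast hkN
    have := mul_le_mul_of_nonneg_left this hpos.le
    rw [hμp, hμm]
    linarith
  have hμp_ne : μp ≠ 1 := by
    rintro rfl
    rw [hδ, hε, div_one] at hcase
    exact hcase.false
  have hμp_lt : μp < 1 := lt_of_le_of_ne hμp1 hμp_ne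
  have hw : υ / μp * μp = υ := div_mul_cancel₀ υ hμp0.ne'
  have hδ' : δ * (μm - 1) = γ - υ := by
    rw [hδ, div_mul_cancel₀ _ (by linarith)]
  have hε' : ε * (μm - μp) = γ - υ / μp := by
    rw [hε, div_mul_cancel₀ _ (by linarith)]
  have hs' : (υ / μp - υ) / (μp - 1) * (μp - 1) = υ / μp - υ :=
    div_mul_cancel₀ _ (by linarith)
  rw [hQ2]
  refine polygon_eq_convexHull hμm0 hmp hμp_lt hυ.le ?_ ?_ (by linarith) (by linarith) ?_
  · exact le_div_self hυ.le hμp0 hμp1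
  · exact (div_le_iff₀ hμp0).2 hk1.le
  · -- the slope `δ` of the long chord is a weighted mean of the other two slopes
    generalize (υ / μp - υ) / (μp - 1) = s at hs' ⊢
    by_contra! hlt
    nlinarith [mul_pos (sub_pos.2 hcase) (sub_pos.2 hmp),
      mul_pos (sub_pos.2 (hcase.trans hlt)) (sub_pos.2 hμp_lt)]
end

section
/- For real numbers x, y the following are equivalent: (i) (x, y) ∈ S₁*, i.e., 0 ≤ x ≤ x^U, y ∈ O, and x·y ≤ w^U; (ii) there exist w ∈ ℝ, v_1, …, v_n ∈ ℝ, and Z_1, …, Z_n ∈ {0, 1} such that 0 ≤ x ≤ x^U, 0 ≤ y ≤ 1, y = Σ_{p=1}^{n} 2^(1-p)·Z_p, w = Σ_{p=1}^{n} 2^(1-p)·v_p, 0 ≤ w ≤ w^U, and for every p = 1, …, n: v_p ≥ 0, v_p ≤ x^U·Z_p, v_p ≤ x, and v_p ≥ x + x^U·Z_p − x^U. In other words, the projection of the mixed-integer linear set S₂ onto the (x, y) variables equals S₁*. -/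
open Finset

/-- The numbers with a binary expansion of `n` digits, the first one being the units digit, are the
multiples `k * 2 ^ (1 - n)` with `k < 2 ^ n`. -/
theorem exists_binary_digits_iff (n : ℕ) (r : ℝ) :
    (∃ Z : Fin n → ℝ, (∀ p, Z p = 0 ∨ Z p = 1) ∧ r = ∑ p : Fin n, 2 ^ (-(p.1 : ℤ)) * Z p) ↔
      ∃ k : ℕ, k < 2 ^ n ∧ r = (k : ℝ) * 2 ^ ((1 : ℤ) - (n : ℤ)) := by
  induction n generalizing r with
  | zero => simp
  | succ n ih =>
    have hpow : (2 : ℝ) ^ ((1 : ℤ) - (n : ℤ)) = 2 * 2 ^ (-(n : ℤ)) := by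
      rw [sub_eq_add_neg, zpow_add₀ two_ne_zero, zpow_one]
    have hpow' : (1 : ℤ) - ((n + 1 : ℕ) : ℤ) = -(n : ℤ) := by push_cast; ring
    rw [hpow']
    constructor
    · rintro ⟨Z, hZ, rfl⟩
      obtain ⟨k, hk, hsum⟩ := (ih _).1 ⟨fun p => Z p.castSucc, fun p => hZ _, rfl⟩
      rw [Fin.sum_univ_castSucc]
      simp only [Fin.val_castSucc, Fin.val_last]
      rw [hsum, hpow]
      rcases hZ (Fin.last n) with h | h
      · exact ⟨2 * k, by rw [pow_succ]; omega, by rw [h]; push_cast; ring⟩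
      · exact ⟨2 * k + 1, by rw [pow_succ]; omega, by rw [h]; push_cast; ring⟩
    · rintro ⟨k, hk, rfl⟩
      obtain ⟨Z, hZ, hsum⟩ := (ih _).2 ⟨k / 2, by rw [pow_succ] at hk; omega, rfl⟩
      refine ⟨Fin.snoc (α := fun _ => ℝ) Z ((k % 2 : ℕ) : ℝ), fun p => ?_, ?_⟩
      · refine Fin.lastCases ?_ (fun q => ?_) p
        · rw [Fin.snoc_last]
          exact_mod_cast Nat.mod_two_eq_zero_or_one k
        · rw [Fin.snoc_castSucc]
          exact hZ q
      · rw [Fin.sum_univ_castSucc]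
        simp only [Fin.val_castSucc, Fin.val_last, Fin.snoc_castSucc, Fin.snoc_last]
        rw [← hsum, hpow]
        have hk' : (k : ℝ) = 2 * (k / 2 : ℕ) + (k % 2 : ℕ) := by
          exact_mod_cast (Nat.div_add_mod k 2).symm
        rw [hk']
        ring

theorem stmt_17
    (n : ℕ) (hn : 0 < n)
    (O : Set ℝ)
    (hO : O = {r : ℝ | ∃ k : ℕ, k ≤ 2 ^ (n - 1) ∧ r = (k : ℝ) * 2 ^ ((1 : ℤ) - (n : ℤ))})
    (xU wU : ℝ) (hwU : 0 < wU) (hwx : wU < xU)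
    (x y : ℝ)
    :
    (0 ≤ x ∧ x ≤ xU ∧ y ∈ O ∧ x * y ≤ wU) ↔
      ∃ (w : ℝ) (v Z : Fin n → ℝ), (∀ p, Z p = 0 ∨ Z p = 1) ∧
        0 ≤ x ∧ x ≤ xU ∧ 0 ≤ y ∧ y ≤ 1 ∧
        y = ∑ p : Fin n, 2 ^ (-(p.1 : ℤ)) * Z p ∧
        w = ∑ p : Fin n, 2 ^ (-(p.1 : ℤ)) * v p ∧
        0 ≤ w ∧ w ≤ wU ∧
        ∀ p, 0 ≤ v p ∧ v p ≤ xU * Z p ∧ v p ≤ x ∧ x + xU * Z p - xU ≤ v p := by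
  subst hO
  have hscale : (2 : ℝ) ^ (n - 1) * 2 ^ ((1 : ℤ) - (n : ℤ)) = 1 := by
    rw [← zpow_natCast, ← zpow_add₀ two_ne_zero, Nat.cast_sub hn]
    simp
  have hpos : (0 : ℝ) < 2 ^ ((1 : ℤ) - (n : ℤ)) := by positivity
  have hsum_mul (Z : Fin n → ℝ) :
      ∑ p : Fin n, (2 : ℝ) ^ (-(p.1 : ℤ)) * (x * Z p) =
        x * ∑ p : Fin n, (2 : ℝ) ^ (-(p.1 : ℤ)) * Z p := by
    rw [Finset.mul_sum]
    exact Finset.sum_congr rfl fun p _ => by ring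
  constructor
  · rintro ⟨hx0, hx, ⟨k, hk, hy⟩, hxy⟩
    have hk' : k < 2 ^ n := hk.trans_lt (Nat.pow_lt_pow_right one_lt_two (by omega))
    obtain ⟨Z, hZ, hyZ⟩ := (exists_binary_digits_iff n y).2 ⟨k, hk', hy⟩
    have hy0 : 0 ≤ y := by rw [hy]; positivity
    have hy1 : y ≤ 1 := by
      rw [hy, ← hscale]
      gcongr
      exact_mod_cast hk
    refine ⟨x * y, fun p => x * Z p, Z, hZ, hx0, hx, hy0, hy1, hyZ, ?_, mul_nonneg hx0 hy0, hxy,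
      fun p => ?_⟩
    · rw [hsum_mul, ← hyZ]
    · rcases hZ p with h | h <;> simp [h, hx0, hx]
  · rintro ⟨w, v, Z, hZ, hx0, hx, -, hy1, hyZ, hwv, -, hw, hv⟩
    obtain ⟨k, -, hy⟩ := (exists_binary_digits_iff n y).1 ⟨Z, hZ, hyZ⟩
    refine ⟨hx0, hx, ⟨k, ?_, hy⟩, ?_⟩
    · rw [hy, ← hscale] at hy1
      exact_mod_cast le_of_mul_le_mul_right hy1 hpos
    · have hvZ : v = fun p => x * Z p := by
        funext p
        obtain ⟨h0, h1, h2, h3⟩ := hv p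
        rcases hZ p with h | h <;> rw [h] at h1 h3 ⊢ <;> linarith
      rw [hvZ, hsum_mul, ← hyZ] at hwv
      exact hwv ▸ hw
end

section
/- The convex hull of S* equals the set {(r, f) ∈ ℝ² : 0 ≤ r ≤ 1, 0 ≤ f ≤ γ} intersected with (i) the half-plane {f ≤ δ·(r − 1) + υ} when δ ≥ ε, or (ii) the intersection of half-planes {f ≤ ε·(r − μ⁻) + γ} and {f ≤ ((υ/μ⁺ − υ)/(μ⁺ − 1))·(r − 1) + υ} when δ < ε. (Full statement of Proposition 1 covering both cases.) -/
open Finset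

/-- A convex set containing two vertical segments of positive heights `u`, `v` standing on the
horizontal axis contains the trapezoid they span. -/
theorem Convex.mem_of_mem_trapezoid {C : Set (ℝ × ℝ)} (hC : Convex ℝ C) {a b u v r f : ℝ}
    (hab : a < b) (hu : 0 < u) (hv : 0 < v)
    (ha : ∀ t, 0 ≤ t → t ≤ u → (a, t) ∈ C) (hb : ∀ t, 0 ≤ t → t ≤ v → (b, t) ∈ C)
    (har : a ≤ r) (hrb : r ≤ b) (hf : 0 ≤ f)
    (hfle : f * (b - a) ≤ u * (b - r) + v * (r - a)) : (r, f) ∈ C := by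
  have hba : 0 < b - a := sub_pos.2 hab
  have hg : 0 < u * (b - r) + v * (r - a) := by
    rcases har.eq_or_lt with rfl | har
    · nlinarith [mul_pos hu hba]
    · nlinarith [mul_nonneg hu.le (sub_nonneg.2 hrb), mul_pos hv (sub_pos.2 har)]
  set g := u * (b - r) + v * (r - a) with hgdef
  set c := f * (b - a) / g with hc
  have hc0 : 0 ≤ c := by positivity
  have hc1 : c ≤ 1 := (div_le_one hg).2 hfle
  have hcg : c * g = f * (b - a) := div_mul_cancel₀ _ hg.ne'
  have key := hC (ha (c * u) (by positivity) (by nlinarith)) (hb (c * v) (by positivity)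
    (by nlinarith)) (div_nonneg (sub_nonneg.2 hrb) hba.le) (div_nonneg (sub_nonneg.2 har) hba.le)
    (by field_simp; ring)
  convert key using 1
  ext
  · simp only [Prod.smul_mk, Prod.mk_add_mk, smul_eq_mul]
    field_simp
    ring
  · simp only [Prod.smul_mk, Prod.mk_add_mk, smul_eq_mul]
    field_simp
    rw [hgdef] at hcg
    linarith

/-- The part of the plane strip `0 ≤ f ≤ γ` over `[0, 1]` lying below a line is convex. -/
theorem convex_box_inter_halfPlane (γ s a c : ℝ) :
    Convex ℝ {p : ℝ × ℝ | 0 ≤ p.1 ∧ p.1 ≤ 1 ∧ 0 ≤ p.2 ∧ p.2 ≤ γ ∧ p.2 ≤ s * (p.1 - a) + c} := by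
  rintro ⟨x, y⟩ ⟨h1, h2, h3, h4, h5⟩ ⟨x', y'⟩ ⟨h1', h2', h3', h4', h5'⟩ t t' ht ht' htt
  obtain rfl : t' = 1 - t := by linarith
  simp only [Set.mem_ofPred_eq, Prod.smul_mk, Prod.mk_add_mk, smul_eq_mul] at *
  refine ⟨by positivity, ?_, by positivity, ?_, ?_⟩
  · linarith [mul_le_mul_of_nonneg_left h2 ht, mul_le_mul_of_nonneg_left h2' ht']
  · linarith [mul_le_mul_of_nonneg_left h4 ht, mul_le_mul_of_nonneg_left h4' ht']
  · linarith [mul_le_mul_of_nonneg_left h5 ht, mul_le_mul_of_nonneg_left h5' ht']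

section TruncatedHyperbola

variable {γ υ m p : ℝ} {S : Set (ℝ × ℝ)}

/-- A point of the hyperbola's subgraph over `[p, 1]` lies below the chord from `p` to `1`. -/
theorem le_chord_of_mul_le (hυ : 0 < υ) (hp : 0 < p) {r f : ℝ} (hpr : p ≤ r) (hr : r ≤ 1)
    (hfr : f * r ≤ υ) : f ≤ υ / p * (1 - r) + υ := by
  have hr0 : 0 < r := hp.trans_le hpr
  have h1 : f ≤ υ / r := (le_div_iff₀ hr0).2 hfr
  have h2 : υ / r = υ / r * (1 - r) + υ := by field_simp; ring
  have h3 : υ / r ≤ υ / p := div_le_div_of_nonneg_left hυ.le hp hpr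
  nlinarith [mul_le_mul_of_nonneg_right h3 (sub_nonneg.2 hr)]

theorem chord_slope (hp : 0 < p) (hp1 : p < 1) : (υ / p - υ) / (p - 1) = -(υ / p) := by
  have : p - 1 ≠ 0 := by linarith
  field_simp
  ring

theorem mem_convexHull_of_le_left (hγ : 0 < γ)
    (hm : 0 ≤ m) (hS0 : ∀ t, 0 ≤ t → t ≤ γ → ((0 : ℝ), t) ∈ S)
    (hSm : ∀ t, 0 ≤ t → t ≤ γ → (m, t) ∈ S) {r f : ℝ} (hr : 0 ≤ r) (hrm : r ≤ m)
    (hf : 0 ≤ f) (hfγ : f ≤ γ) : (r, f) ∈ convexHull ℝ S := by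
  rcases hm.eq_or_lt with rfl | hm
  · obtain rfl : r = 0 := le_antisymm hrm hr
    exact subset_convexHull ℝ S (hS0 f hf hfγ)
  · exact (convex_convexHull ℝ S).mem_of_mem_trapezoid hm hγ hγ
      (fun t h h' => subset_convexHull ℝ S (hS0 t h h'))
      (fun t h h' => subset_convexHull ℝ S (hSm t h h')) hr hrm hf (by nlinarith)

theorem convexHull_eq_of_ge (hυ : 0 < υ) (hγυ : υ < γ) (hm : 0 ≤ m) (hmp : m < p) (hp1 : p ≤ 1)
    (hS : ∀ q ∈ S, 0 ≤ q.1 ∧ q.1 ≤ 1 ∧ (q.1 ≤ m ∨ p ≤ q.1) ∧ 0 ≤ q.2 ∧ q.2 ≤ γ ∧ q.2 * q.1 ≤ υ)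
    (hS0 : ∀ t, 0 ≤ t → t ≤ γ → ((0 : ℝ), t) ∈ S) (hSm : ∀ t, 0 ≤ t → t ≤ γ → (m, t) ∈ S)
    (hS1 : ∀ t, 0 ≤ t → t ≤ υ → ((1 : ℝ), t) ∈ S)
    (h : (γ - υ) / (m - 1) ≥ (γ - υ / p) / (m - p)) :
    convexHull ℝ S = {q : ℝ × ℝ | 0 ≤ q.1 ∧ q.1 ≤ 1 ∧ 0 ≤ q.2 ∧ q.2 ≤ γ ∧
      q.2 ≤ (γ - υ) / (m - 1) * (q.1 - 1) + υ} := by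
  have hp : 0 < p := hm.trans_lt hmp
  have hδ : (γ - υ) / (m - 1) * (m - 1) = γ - υ := div_mul_cancel₀ _ (by linarith)
  have hε : (γ - υ / p) / (m - p) * (m - p) = γ - υ / p := div_mul_cancel₀ _ (by linarith)
  have hδneg : (γ - υ) / (m - 1) < 0 := div_neg_of_pos_of_neg (by linarith) (by linarith)
  have hqp : υ / p * p = υ := div_mul_cancel₀ _ hp.ne'
  generalize (γ - υ) / (m - 1) = δ at *
  generalize (γ - υ / p) / (m - p) = ε at *
  apply subset_antisymm
  · refine convexHull_min ?_ ?_
    · rintro ⟨r, f⟩ hq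
      obtain ⟨h1, h2, h3, h4, h5, h6⟩ := hS _ hq
      refine ⟨h1, h2, h4, h5, ?_⟩
      dsimp only at *
      rcases h3 with h3 | h3
      · nlinarith
      · have hch := le_chord_of_mul_le hυ hp h3 h2 h6
        rcases h2.eq_or_lt with rfl | h2
        · linarith
        · have hslope : υ / p ≤ -δ := by
            have : (υ / p) * (1 - p) ≤ -δ * (1 - p) := by nlinarith
            exact le_of_mul_le_mul_right this (by linarith)
          nlinarith
    · exact convex_box_inter_halfPlane γ δ 1 υ
  · rintro ⟨r, f⟩ ⟨h1, h2, h3, h4, h5⟩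
    dsimp only at *
    rcases le_total r m with hr | hr
    · exact mem_convexHull_of_le_left (hυ.trans hγυ) hm hS0 hSm h1 hr h3 h4
    · refine (convex_convexHull ℝ S).mem_of_mem_trapezoid (hmp.trans_le hp1) (hυ.trans hγυ) hυ
        (fun t h h' => subset_convexHull ℝ S (hSm t h h'))
        (fun t h h' => subset_convexHull ℝ S (hS1 t h h')) hr h2 h3 ?_
      have h6 := mul_le_mul_of_nonneg_right h5 (show 0 ≤ 1 - m by linarith)
      have h7 : (δ * (r - 1) + υ) * (1 - m) = γ * (1 - r) + υ * (r - m) := by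
        linear_combination (1 - r) * hδ
      linarith

theorem convexHull_eq_of_lt (hυ : 0 < υ) (hm : 0 ≤ m) (hmp : m < p) (hp1 : p ≤ 1)
    (hγυ : υ < γ) (hpγ : υ / p < γ)
    (hS : ∀ q ∈ S, 0 ≤ q.1 ∧ q.1 ≤ 1 ∧ (q.1 ≤ m ∨ p ≤ q.1) ∧ 0 ≤ q.2 ∧ q.2 ≤ γ ∧ q.2 * q.1 ≤ υ)
    (hS0 : ∀ t, 0 ≤ t → t ≤ γ → ((0 : ℝ), t) ∈ S) (hSm : ∀ t, 0 ≤ t → t ≤ γ → (m, t) ∈ S)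
    (hSp : ∀ t, 0 ≤ t → t ≤ υ / p → (p, t) ∈ S)
    (hS1 : ∀ t, 0 ≤ t → t ≤ υ → ((1 : ℝ), t) ∈ S)
    (h : (γ - υ) / (m - 1) < (γ - υ / p) / (m - p)) :
    convexHull ℝ S = {q : ℝ × ℝ | 0 ≤ q.1 ∧ q.1 ≤ 1 ∧ 0 ≤ q.2 ∧ q.2 ≤ γ ∧
      q.2 ≤ (γ - υ / p) / (m - p) * (q.1 - m) + γ ∧
      q.2 ≤ (υ / p - υ) / (p - 1) * (q.1 - 1) + υ} := by
  have hp : 0 < p := hm.trans_lt hmp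
  replace hp1 : p < 1 := by
    refine hp1.lt_of_ne ?_
    rintro rfl
    simp at h
  rw [chord_slope hp hp1]
  have hδ : (γ - υ) / (m - 1) * (m - 1) = γ - υ := div_mul_cancel₀ _ (by linarith)
  have hε : (γ - υ / p) / (m - p) * (m - p) = γ - υ / p := div_mul_cancel₀ _ (by linarith)
  have hεneg : (γ - υ / p) / (m - p) < 0 := div_neg_of_pos_of_neg (by linarith) (by linarith)
  have hqp : υ / p * p = υ := div_mul_cancel₀ _ hp.ne'
  have hq : 0 < υ / p := by positivity
  generalize (γ - υ) / (m - 1) = δ at *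
  generalize (γ - υ / p) / (m - p) = ε at *
  generalize υ / p = q at *
  have hslope : -q < ε := by
    have : -δ * (1 - p) < q * (1 - p) := by nlinarith
    linarith [lt_of_mul_lt_mul_right this (by linarith)]
  apply subset_antisymm
  · refine convexHull_min ?_ ?_
    · rintro ⟨r, f⟩ hq
      obtain ⟨h1, h2, h3, h4, h5, h6⟩ := hS _ hq
      refine ⟨h1, h2, h4, h5, ?_⟩
      dsimp only at *
      rcases h3 with h3 | h3
      · constructor <;> nlinarith
      · have hch := le_chord_of_mul_le hυ hp h3 h2 h6
        rw [← hqp, mul_div_cancel_right₀ _ hp.ne', hqp] at hch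
        constructor <;> nlinarith
    · refine (congrArg (Convex ℝ) (Set.ext fun x => ?_)).mp
        ((convex_box_inter_halfPlane γ ε m γ).inter (convex_box_inter_halfPlane γ (-q) 1 υ))
      simp only [Set.mem_ofPred_eq, Set.mem_inter_iff]
      tauto
  · rintro ⟨r, f⟩ ⟨h1, h2, h3, h4, h5, h6⟩
    dsimp only at *
    rcases le_total r m with hr | hr
    · exact mem_convexHull_of_le_left (hυ.trans hγυ) hm hS0 hSm h1 hr h3 h4
    have hC := convex_convexHull ℝ S
    have hsub := subset_convexHull ℝ S
    rcases le_total r p with hr' | hr'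
    · refine hC.mem_of_mem_trapezoid hmp (hυ.trans hγυ) hq (fun t h h' => hsub (hSm t h h'))
        (fun t h h' => hsub (hSp t h h')) hr hr' h3 ?_
      have h7 := mul_le_mul_of_nonneg_right h5 (show 0 ≤ p - m by linarith)
      have h8 : (ε * (r - m) + γ) * (p - m) = γ * (p - r) + q * (r - m) := by
        linear_combination (m - r) * hε
      linarith
    · refine hC.mem_of_mem_trapezoid hp1 hq hυ (fun t h h' => hsub (hSp t h h'))
        (fun t h h' => hsub (hS1 t h h')) hr' h2 h3 ?_
      have h7 := mul_le_mul_of_nonneg_right h6 (show 0 ≤ 1 - p by linarith)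
      have h8 : (-q * (r - 1) + υ) * (1 - p) = q * (1 - r) + υ * (r - p) := by
        linear_combination (r - 1) * hqp
      linarith

end TruncatedHyperbola

theorem stmt_19
    (n : ℕ) (hn : 0 < n)
    (γ υ : ℝ) (hυ : 0 < υ) (hγυ : υ < γ)
    (O : Set ℝ)
    (hO : O = {r : ℝ | ∃ k : ℕ, k ≤ 2 ^ (n - 1) ∧ r = (k : ℝ) * 2 ^ ((1 : ℤ) - (n : ℤ))})
    (Sstar : Set (ℝ × ℝ))
    (hS : Sstar = {p : ℝ × ℝ | p.1 ∈ O ∧ 0 ≤ p.2 ∧ p.2 ≤ γ ∧ p.2 * p.1 ≤ υ})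
    (μm μp : ℝ)
    (hμm : μm = 2 ^ ((1 : ℤ) - (n : ℤ)) * (⌊υ / (2 ^ ((1 : ℤ) - (n : ℤ)) * γ)⌋ : ℝ))
    (hμp : μp = μm + 2 ^ ((1 : ℤ) - (n : ℤ)))
    (δ ε : ℝ)
    (hδ : δ = (γ - υ) / (μm - 1))
    (hε : ε = (γ - υ / μp) / (μm - μp))
    :
    (δ ≥ ε → convexHull ℝ Sstar =
      {p : ℝ × ℝ | 0 ≤ p.1 ∧ p.1 ≤ 1 ∧ 0 ≤ p.2 ∧ p.2 ≤ γ ∧ p.2 ≤ δ * (p.1 - 1) + υ}) ∧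
    (δ < ε → convexHull ℝ Sstar =
      {p : ℝ × ℝ | 0 ≤ p.1 ∧ p.1 ≤ 1 ∧ 0 ≤ p.2 ∧ p.2 ≤ γ ∧
        p.2 ≤ ε * (p.1 - μm) + γ ∧ p.2 ≤ ((υ / μp - υ) / (μp - 1)) * (p.1 - 1) + υ}) := by
  have hγ : 0 < γ := hυ.trans hγυ
  have hh : (0 : ℝ) < 2 ^ ((1 : ℤ) - (n : ℤ)) := by positivity
  have hN : ((2 ^ (n - 1) : ℕ) : ℝ) * 2 ^ ((1 : ℤ) - (n : ℤ)) = 1 := by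
    have : (1 : ℤ) - (n : ℤ) = -((n - 1 : ℕ) : ℤ) := by omega
    rw [this, zpow_neg, zpow_natCast]
    push_cast
    exact mul_inv_cancel₀ (by positivity)
  generalize (2 : ℝ) ^ ((1 : ℤ) - (n : ℤ)) = h at *
  generalize 2 ^ (n - 1) = N at *
  have hhγ : 0 < h * γ := mul_pos hh hγ
  obtain ⟨k, hk⟩ := Int.eq_ofNat_of_zero_le (Int.floor_nonneg.2 (div_pos hυ hhγ).le)
  have hkle := Int.floor_le (υ / (h * γ))
  have hklt := Int.lt_floor_add_one (υ / (h * γ))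
  rw [hk] at hμm hkle hklt
  rw [Int.cast_natCast] at hμm hkle hklt
  rw [le_div_iff₀ hhγ] at hkle
  rw [div_lt_iff₀ hhγ] at hklt
  have hkN : k + 1 ≤ N := by
    have h1 : (k : ℝ) * h < N * h := by
      rw [hN]
      by_contra! hcon
      nlinarith
    exact_mod_cast lt_of_mul_lt_mul_right h1 hh.le
  have hm0 : 0 ≤ μm := by rw [hμm]; positivity
  have hmp : μm < μp := by linarith
  have hp : 0 < μp := hm0.trans_lt hmp
  have hpk : μp = ((k + 1 : ℕ) : ℝ) * h := by rw [hμp, hμm]; push_cast; ring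
  have hp1 : μp ≤ 1 := by
    rw [hpk, ← hN]
    gcongr
  have hpγ : υ / μp < γ := by
    rw [div_lt_iff₀ hp, hpk]
    push_cast
    linarith
  have hmγ : γ * μm ≤ υ := by rw [hμm]; linarith
  have hmem : ∀ q ∈ Sstar, 0 ≤ q.1 ∧ q.1 ≤ 1 ∧ (q.1 ≤ μm ∨ μp ≤ q.1) ∧
      0 ≤ q.2 ∧ q.2 ≤ γ ∧ q.2 * q.1 ≤ υ := by
    rintro ⟨r, f⟩ hq
    rw [hS, hO] at hq
    obtain ⟨⟨j, hj, hr⟩, hrest⟩ := hq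
    dsimp only at hr hrest ⊢
    refine ⟨by rw [hr]; positivity, ?_, ?_, hrest⟩
    · rw [hr, ← hN]
      gcongr
    · rcases Nat.lt_or_ge k j with hkj | hkj
      · right
        rw [hr, hpk]
        gcongr
        exact hkj
      · left
        rw [hr, hμm, mul_comm]
        gcongr
  have hS0 : ∀ t, 0 ≤ t → t ≤ γ → ((0 : ℝ), t) ∈ Sstar := by
    intro t h0 h1
    rw [hS, hO]
    exact ⟨⟨0, by simp⟩, h0, h1, by simpa using hυ.le⟩
  have hSm : ∀ t, 0 ≤ t → t ≤ γ → (μm, t) ∈ Sstar := by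
    intro t h0 h1
    rw [hS, hO]
    exact ⟨⟨k, by omega, by rw [hμm, mul_comm]⟩, h0, h1,
      (mul_le_mul_of_nonneg_right h1 hm0).trans hmγ⟩
  have hSp : ∀ t, 0 ≤ t → t ≤ υ / μp → (μp, t) ∈ Sstar := by
    intro t h0 h1
    rw [hS, hO]
    exact ⟨⟨k + 1, hkN, hpk⟩, h0, h1.trans hpγ.le, (le_div_iff₀ hp).1 h1⟩
  have hS1 : ∀ t, 0 ≤ t → t ≤ υ → ((1 : ℝ), t) ∈ Sstar := by
    intro t h0 h1
    rw [hS, hO]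
    exact ⟨⟨N, le_rfl, hN.symm⟩, h0, h1.trans hγυ.le, by simpa using h1⟩
  rw [hδ, hε]
  exact ⟨convexHull_eq_of_ge hυ hγυ hm0 hmp hp1 hmem hS0 hSm hS1,
    convexHull_eq_of_lt hυ hm0 hmp hp1 hγυ hpγ hmem hS0 hSm hSp hS1⟩
end
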